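/- Let n ≥ 0 be an integer. Let a, b, c, d be holomorphic functions on the punctured unit disk Δ* such that each of z ↦ zⁿ·a(z), z ↦ zⁿ·b(z), z ↦ zⁿ·c(z), z ↦ zⁿ·d(z) extends to a holomorphic function on the full disk Δ, and such that z ↦ a(z)d(z) − b(z)c(z) extends to a holomorphic function on Δ. Then z ↦ z^{2n}·(a'(z)d'(z) − b'(z)c'(z)) extends to a holomorphic function on Δ; that is, Ω₀ = a'd' − b'c' has a pole of order at most 2n at 0. -/

import Mathlib

/-- The open unit disk `Δ ⊆ ℂ`. -/
def unitDisk : Set ℂ := Metric.ball 0 1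

/-- The punctured open unit disk `Δ* = Δ ∖ {0}`. -/
def punctDisk : Set ℂ := Metric.ball 0 1 \ {0}

/-- The Bryant quadratic expression `Ω_α = ∇_α s ∧ ∇_α t` of the frame given
by the functions `a, b, c, d`, for the singular connection
`∇_α = d - Γ_α dz/z` with `Γ_α = diag(α, -α)`. -/
noncomputable def OmegaA (α : ℝ) (a b c d : ℂ → ℂ) (z : ℂ) : ℂ :=
  (deriv a z - (α : ℂ) * a z / z) * (deriv d z + (α : ℂ) * d z / z) -
    (deriv b z + (α : ℂ) * b z / z) * (deriv c z - (α : ℂ) * c z / z)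

theorem isOpen_unitDisk : IsOpen unitDisk := Metric.isOpen_ball

theorem isOpen_punctDisk : IsOpen punctDisk := Metric.isOpen_ball.sdiff isClosed_singleton

theorem hasDerivAt_of_mem_punctDisk {f : ℂ → ℂ} (hf : DifferentiableOn ℂ f punctDisk) {z : ℂ}
    (hz : z ∈ punctDisk) : HasDerivAt f (deriv f z) z :=
  (hf.differentiableAt (isOpen_punctDisk.mem_nhds hz)).hasDerivAt

theorem deriv_eq_of_eqOn_punctDisk {f g : ℂ → ℂ} {g' z : ℂ} (hfg : ∀ w ∈ punctDisk, f w = g w)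
    (hz : z ∈ punctDisk) (hg : HasDerivAt g g' z) : deriv f z = g' :=
  (hg.congr_of_eventuallyEq
    (Filter.eventuallyEq_of_mem (isOpen_punctDisk.mem_nhds hz) hfg)).deriv

theorem deriv_eq_of_eq_pow_mul {n : ℕ} {f g : ℂ → ℂ} (hf : DifferentiableOn ℂ f punctDisk)
    (hg : ∀ w ∈ punctDisk, g w = w ^ n * f w) {z : ℂ} (hz : z ∈ punctDisk) :
    deriv g z = n * z ^ (n - 1) * f z + z ^ n * deriv f z :=
  deriv_eq_of_eqOn_punctDisk hg hz ((hasDerivAt_pow n z).mul (hasDerivAt_of_mem_punctDisk hf hz))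

/-- If `zⁿa, zⁿb, zⁿc, zⁿd` and `ad - bc` extend holomorphically to the disk,
then `z^{2n}·(a'd' - b'c')` extends holomorphically: `Ω₀` has a pole of order
at most `2n`. -/
theorem stmt_8 (n : ℕ) (a b c d : ℂ → ℂ)
    (ha : DifferentiableOn ℂ a punctDisk) (hb : DifferentiableOn ℂ b punctDisk)
    (hc : DifferentiableOn ℂ c punctDisk) (hd : DifferentiableOn ℂ d punctDisk)
    (hea : ∃ A : ℂ → ℂ, DifferentiableOn ℂ A unitDisk ∧
      ∀ z ∈ punctDisk, A z = z ^ n * a z)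
    (heb : ∃ B : ℂ → ℂ, DifferentiableOn ℂ B unitDisk ∧
      ∀ z ∈ punctDisk, B z = z ^ n * b z)
    (hec : ∃ C : ℂ → ℂ, DifferentiableOn ℂ C unitDisk ∧
      ∀ z ∈ punctDisk, C z = z ^ n * c z)
    (hed : ∃ D : ℂ → ℂ, DifferentiableOn ℂ D unitDisk ∧
      ∀ z ∈ punctDisk, D z = z ^ n * d z)
    (hdet : ∃ E : ℂ → ℂ, DifferentiableOn ℂ E unitDisk ∧
      ∀ z ∈ punctDisk, E z = a z * d z - b z * c z) :
    ∃ F : ℂ → ℂ, DifferentiableOn ℂ F unitDisk ∧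
      ∀ z ∈ punctDisk,
        F z = z ^ (2 * n) * (deriv a z * deriv d z - deriv b z * deriv c z) := by
  obtain ⟨A, hA, hAa⟩ := hea
  obtain ⟨B, hB, hBb⟩ := heb
  obtain ⟨C, hC, hCc⟩ := hec
  obtain ⟨D, hD, hDd⟩ := hed
  obtain ⟨E, hE, hEdet⟩ := hdet
  refine ⟨fun z => deriv A z * deriv D z - deriv B z * deriv C z
    - (n : ℂ) ^ 2 * z ^ (2 * n - 2) * E z - (n : ℂ) * z ^ (2 * n - 1) * deriv E z, ?_, ?_⟩
  · have hA' := hA.deriv isOpen_unitDisk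
    have hB' := hB.deriv isOpen_unitDisk
    have hC' := hC.deriv isOpen_unitDisk
    have hD' := hD.deriv isOpen_unitDisk
    have hE' := hE.deriv isOpen_unitDisk
    fun_prop
  · intro z hz
    have hE' := deriv_eq_of_eqOn_punctDisk hEdet hz
      (((hasDerivAt_of_mem_punctDisk ha hz).mul (hasDerivAt_of_mem_punctDisk hd hz)).sub
        ((hasDerivAt_of_mem_punctDisk hb hz).mul (hasDerivAt_of_mem_punctDisk hc hz)))
    simp only [deriv_eq_of_eq_pow_mul ha hAa hz, deriv_eq_of_eq_pow_mul hb hBb hz,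
      deriv_eq_of_eq_pow_mul hc hCc hz, deriv_eq_of_eq_pow_mul hd hDd hz, hE', hEdet z hz]
    cases n with
    | zero => simp
    | succ m =>
      rw [show 2 * (m + 1) - 2 = 2 * m by lia, show 2 * (m + 1) - 1 = 2 * m + 1 by lia,
        Nat.add_sub_cancel]
      ring
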